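/- Let p be a prime, r ≥ 1, m ≥ 1, and let A be an m × m matrix over Z_{p^r}. Let s be the system height of ((Z_{p^r})^m, x ↦ A x) and let s_1 be the system height of the reduced system ((Z_p)^m, x ↦ (A mod p) x). Then s_1 ≤ s ≤ r · s_1. -/

import Mathlib

/-- An element `x` is a cycle vertex of the system `(M, f)` if `f^[l] x = x`
for some positive integer `l`. -/
def IsCycleVertex {M : Type*} (f : M → M) (x : M) : Prop :=
  ∃ l : ℕ, 0 < l ∧ f^[l] x = x

/-- The height of an element `x`: the least `k` such that `f^[k] x` is a cycle vertex. -/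
noncomputable def height {M : Type*} (f : M → M) (x : M) : ℕ :=
  sInf {k : ℕ | IsCycleVertex f (f^[k] x)}

/-- The system height: the maximum height over all elements. -/
noncomputable def systemHeight {M : Type*} (f : M → M) : ℕ :=
  sSup (Set.range (height f))

theorem IsCycleVertex.iterate {M : Type*} {f : M → M} {x : M} (h : IsCycleVertex f x) (n : ℕ) :
    IsCycleVertex f (f^[n] x) := by
  obtain ⟨l, hl, hx⟩ := h
  refine ⟨l, hl, ?_⟩
  rw [← Function.iterate_add_apply, add_comm, Function.iterate_add_apply, hx]

theorem exists_isCycleVertex_iterate {M : Type*} [Finite M] (f : M → M) (x : M) :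
    ∃ k, IsCycleVertex f (f^[k] x) := by
  obtain ⟨a, b, hab, h⟩ :=
    Finite.exists_ne_map_eq_of_infinite (fun n : ℕ => f^[n] x)
  wlog hlt : a < b generalizing a b
  · exact this b a hab.symm h.symm (by omega)
  refine ⟨a, b - a, by omega, ?_⟩
  rw [← Function.iterate_add_apply, Nat.sub_add_cancel hlt.le]
  exact h.symm

theorem height_le_iff {M : Type*} [Finite M] (f : M → M) (x : M) (k : ℕ) :
    height f x ≤ k ↔ IsCycleVertex f (f^[k] x) := by
  refine ⟨fun h => ?_, fun h => Nat.sInf_le h⟩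
  have h0 : IsCycleVertex f (f^[height f x] x) := Nat.sInf_mem (exists_isCycleVertex_iterate f x)
  have := h0.iterate (k - height f x)
  rwa [← Function.iterate_add_apply, Nat.sub_add_cancel h] at this

theorem systemHeight_le_iff {M : Type*} [Finite M] [Nonempty M] (f : M → M) (k : ℕ) :
    systemHeight f ≤ k ↔ ∀ x, IsCycleVertex f (f^[k] x) := by
  rw [systemHeight, csSup_le_iff (Set.finite_range _).bddAbove (Set.range_nonempty _)]
  simp only [Set.forall_mem_range, height_le_iff]

theorem Monoid.exists_pow_add_eq_pow {G : Type*} [Monoid G] [Finite G] (a : G) :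
    ∃ i j : ℕ, 0 < j ∧ a ^ (i + j) = a ^ i := by
  obtain ⟨i, j, hj, h⟩ := exists_isCycleVertex_iterate (a * ·) 1
  refine ⟨i, j, hj, ?_⟩
  simpa [mul_left_iterate, ← pow_add, add_comm] using h

theorem Matrix.iterate_mulVec {R n : Type*} [CommSemiring R] [Fintype n] [DecidableEq n]
    (A : Matrix n n R) (k : ℕ) (x : n → R) : A.mulVec^[k] x = (A ^ k).mulVec x := by
  induction k with
  | zero => simp
  | succ k ih => rw [Function.iterate_succ_apply', ih, Matrix.mulVec_mulVec, pow_succ']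

theorem systemHeight_mulVec_le_iff {R n : Type*} [CommRing R] [Finite R] [Fintype n]
    [DecidableEq n] (A : Matrix n n R) (k : ℕ) :
    systemHeight A.mulVec ≤ k ↔ ∃ j, 0 < j ∧ A ^ (k + j) = A ^ k := by
  have : Finite (Matrix n n R) := inferInstanceAs (Finite (n → n → R))
  rw [systemHeight_le_iff]
  constructor
  · intro h
    obtain ⟨i, j, hj, hij⟩ := Monoid.exists_pow_add_eq_pow A
    refine ⟨j, hj, Matrix.mulVec_injective (funext fun x => ?_)⟩
    obtain ⟨l, hl, hx⟩ := h x
    have hfix : A.mulVec^[l * i] (A.mulVec^[k] x) = A.mulVec^[k] x := by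
      rw [Function.iterate_mul]
      exact Function.iterate_fixed hx i
    have hle : i ≤ l * i := Nat.le_mul_of_pos_left i hl
    obtain ⟨d, hd⟩ := Nat.exists_eq_add_of_le hle
    rw [← Function.iterate_add_apply, Matrix.iterate_mulVec, Matrix.iterate_mulVec] at hfix
    have hpow : A ^ (j + (l * i + k)) = A ^ (l * i + k) := by
      rw [hd, show j + (i + d + k) = (i + j) + (d + k) by ring, pow_add, hij, ← pow_add,
        add_assoc]
    rw [add_comm, pow_add, ← Matrix.mulVec_mulVec, ← hfix, Matrix.mulVec_mulVec, ← pow_add, hpow]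
  · rintro ⟨j, hj, h⟩ x
    refine ⟨j, hj, ?_⟩
    rw [← Function.iterate_add_apply, Matrix.iterate_mulVec, Matrix.iterate_mulVec, add_comm, h]

theorem exists_pow_add_eq_pow_of_pow_eq_mul {G : Type*} [Monoid G] [Finite G] {a c : G} {k : ℕ}
    (h : a ^ k = a ^ (k + 1) * c) : ∃ j, 0 < j ∧ a ^ (k + j) = a ^ k := by
  obtain ⟨i, j, hj, hij⟩ := Monoid.exists_pow_add_eq_pow a
  have key : ∀ n, a ^ k = a ^ (k + n) * c ^ n := by
    intro n
    induction n with
    | zero => simp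
    | succ n ih =>
      calc a ^ k = a ^ n * a ^ k * c ^ n := by rw [← pow_add, add_comm n k, ← ih]
        _ = a ^ n * (a ^ (k + 1) * c) * c ^ n := by rw [← h]
        _ = a ^ (k + (n + 1)) * c ^ (n + 1) := by
          rw [pow_succ' c, ← mul_assoc, ← mul_assoc, ← pow_add]
          congr 3
          omega
  refine ⟨j, hj, ?_⟩
  calc a ^ (k + j) = a ^ j * (a ^ (k + i) * c ^ i) := by rw [← key i, ← pow_add, add_comm]
    _ = a ^ k * a ^ (i + j) * c ^ i := by
      rw [← mul_assoc, ← pow_add, ← pow_add]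
      congr 2
      omega
    _ = a ^ k := by rw [hij, ← pow_add, ← key i]

theorem exists_pow_add_eq_pow_of_pow_sub_eq_zero {S : Type*} [Ring S] [Finite S] {a : S}
    {k j r : ℕ} (hj : 0 < j) (h : (a ^ k - a ^ (k + j)) ^ r = 0) :
    ∃ l, 0 < l ∧ a ^ (r * k + l) = a ^ (r * k) := by
  have hc : a ^ k - a ^ (k + j) = a ^ k * (1 - a ^ j) := by rw [mul_sub, mul_one, pow_add]
  have hcomm : Commute (a ^ k) (1 - a ^ j) :=
    (Commute.one_right _).sub_right (Commute.pow_pow_self a k j)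
  rw [hc, hcomm.mul_pow, ← pow_mul, mul_comm k r] at h
  have hg := (Commute.one_left (1 - a ^ j)).mul_geom_sum₂ r
  rw [one_pow, sub_sub_cancel] at hg
  obtain ⟨i, rfl⟩ := Nat.exists_eq_add_of_lt hj
  refine exists_pow_add_eq_pow_of_pow_eq_mul
    (c := a ^ i * ∑ n ∈ Finset.range r, 1 ^ n * (1 - a ^ (0 + i + 1)) ^ (r - 1 - n)) ?_
  have h1 : a ^ (r * k) = a ^ (r * k) * (1 - (1 - a ^ (0 + i + 1)) ^ r) := by
    rw [mul_sub, h, mul_one, sub_zero]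
  rw [h1, ← hg, ← mul_assoc, ← mul_assoc, ← pow_add, ← pow_add]
  congr 2
  omega

theorem ZMod.exists_eq_mul_of_castHom_eq_zero {n p : ℕ} [NeZero n] (h : p ∣ n) {x : ZMod n}
    (hx : ZMod.castHom h (ZMod p) x = 0) : ∃ y, x = p * y := by
  rw [← ZMod.natCast_zmod_val x, map_natCast, ZMod.natCast_eq_zero_iff] at hx
  obtain ⟨c, hc⟩ := hx
  exact ⟨c, by rw [← ZMod.natCast_zmod_val x, hc, Nat.cast_mul]⟩

theorem Matrix.pow_eq_zero_of_map_castHom_eq_zero {n : Type*} [Fintype n] [DecidableEq n]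
    {p r : ℕ} [NeZero (p ^ r)] (h : p ∣ p ^ r) {B : Matrix n n (ZMod (p ^ r))}
    (hB : B.map (ZMod.castHom h (ZMod p)) = 0) : B ^ r = 0 := by
  have hex : ∀ i j, ∃ y, B i j = p * y := fun i j =>
    ZMod.exists_eq_mul_of_castHom_eq_zero h (congrFun (congrFun hB i) j)
  choose C hC using hex
  have hBC : B = (p : ZMod (p ^ r)) • Matrix.of C := by
    ext i j
    simp [hC]
  rw [hBC, smul_pow, ← Nat.cast_pow, ZMod.natCast_self, zero_smul]

/-- If `s` is the system height of `((ZMod (p^r))^m, x ↦ A x)` and `s₁` the system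
height of the reduced system `((ZMod p)^m, x ↦ (A mod p) x)`, then `s₁ ≤ s ≤ r·s₁`. -/
theorem systemHeight_bounds_of_reduced
    (p r m : ℕ) (hp : p.Prime) (hr : 1 ≤ r) (hm : 1 ≤ m)
    (A : Matrix (Fin m) (Fin m) (ZMod (p ^ r)))
    (s s₁ : ℕ) (hs : s = systemHeight A.mulVec)
    (hs₁ : s₁ = systemHeight ((A.map (ZMod.cast : ZMod (p ^ r) → ZMod p)).mulVec)) :
    s₁ ≤ s ∧ s ≤ r * s₁ := by
  have : NeZero p := ⟨hp.ne_zero⟩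
  have hdvd : p ∣ p ^ r := dvd_pow_self p (by omega)
  let φ := (ZMod.castHom hdvd (ZMod p)).mapMatrix (m := Fin m)
  have hφ : A.map (ZMod.cast : ZMod (p ^ r) → ZMod p) = φ A := rfl
  rw [hφ] at hs₁
  have : Finite (Matrix (Fin m) (Fin m) (ZMod (p ^ r))) :=
    inferInstanceAs (Finite (Fin m → Fin m → ZMod (p ^ r)))
  constructor
  · obtain ⟨j, hj, h⟩ := (systemHeight_mulVec_le_iff A s).1 hs.ge
    rw [hs₁, systemHeight_mulVec_le_iff]
    exact ⟨j, hj, by rw [← map_pow, h, map_pow]⟩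
  · obtain ⟨j, hj, h⟩ := (systemHeight_mulVec_le_iff (φ A) s₁).1 hs₁.ge
    rw [hs, systemHeight_mulVec_le_iff]
    refine exists_pow_add_eq_pow_of_pow_sub_eq_zero hj
      (Matrix.pow_eq_zero_of_map_castHom_eq_zero hdvd ?_)
    change φ (A ^ s₁ - A ^ (s₁ + j)) = 0
    rw [map_sub, map_pow, map_pow, h, sub_self]
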